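/- For every GFG automaton A = (Σ, Q, Q₀, δ, α) there exists an equivalent tight GFG automaton A' with the same acceptance condition, and A' is defined on a substructure of A, i.e., A' = (Σ, Q, Q₀', δ', α) with Q₀' ⊆ Q₀ and δ'(q,a) ⊆ δ(q,a) for all q ∈ Q and a ∈ Σ. -/

import Mathlib

namespace GFG

/-- The structure of a nondeterministic automaton on infinite words:
alphabet `A`, states `Q`, initial states and transition function.
The acceptance condition is kept separate, as a predicate on the set
of states visited infinitely often. -/
structure Auto (A Q : Type) where
  init : Set Q
  next : Q → A → Set Q

variable {A Q Mem : Type}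

/-- `r` is a run of the automaton `M` on the infinite word `w`. -/
def Auto.IsRun (M : Auto A Q) (w : ℕ → A) (r : ℕ → Q) : Prop :=
  r 0 ∈ M.init ∧ ∀ i, r (i + 1) ∈ M.next (r i) (w i)

/-- The set of states occurring infinitely often in `r`. -/
def InfOcc (r : ℕ → Q) : Set Q := {q | ∀ n, ∃ m, n ≤ m ∧ r m = q}

/-- The language of `M` with acceptance condition `acc` (a predicate on `inf(r)`). -/
def Auto.Lang (M : Auto A Q) (acc : Set Q → Prop) : Set (ℕ → A) :=
  {w | ∃ r, M.IsRun w r ∧ acc (InfOcc r)}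

/-- `M` is deterministic: one initial state and at most one successor per state/letter. -/
def Auto.IsDet (M : Auto A Q) : Prop :=
  (∃ q0, M.init = {q0}) ∧ ∀ q a, (M.next q a).Subsingleton

/-- `A^q`: the automaton `M` with set of initial states `{q}`. -/
def Auto.withInit (M : Auto A Q) (q : Q) : Auto A Q := ⟨{q}, M.next⟩

/-- Büchi condition: `inf(r) ∩ α ≠ ∅`. -/
def BuchiAcc (α : Set Q) (S : Set Q) : Prop := (S ∩ α).Nonempty

/-- co-Büchi condition: `inf(r) ∩ α = ∅`. -/
def CoBuchiAcc (α : Set Q) (S : Set Q) : Prop := S ∩ α = ∅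

/-- Rabin condition with bad sets `E i` and good sets `F i`. -/
def RabinAcc {ι : Type} (E F : ι → Set Q) (S : Set Q) : Prop :=
  ∃ i, S ∩ E i = ∅ ∧ (S ∩ F i).Nonempty

/-- Streett condition with pairs `(E i, F i)`. -/
def StreettAcc {ι : Type} (E F : ι → Set Q) (S : Set Q) : Prop :=
  ∀ i, S ∩ E i = ∅ ∨ (S ∩ F i).Nonempty

/-- Parity condition: the minimal priority seen infinitely often is even. -/
def ParityAcc (c : Q → ℕ) (S : Set Q) : Prop := Even (sInf (c '' S))

/-- The prefix of length `n` of the infinite word `w`, as a list. -/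
def prefixWord (w : ℕ → A) (n : ℕ) : List A := (List.range n).map w

/-- The run induced by a strategy `g : A* → Q` on the word `w`:
`g(ε), g(a₁), g(a₁a₂), …`. -/
def StrategyRun (g : List A → Q) (w : ℕ → A) : ℕ → Q := fun n => g (prefixWord w n)

/-- `g` witnesses GFGness of `M` (with acceptance `acc`): for every word `w` the
induced sequence is a run of `M` on `w`, accepting whenever `w ∈ L(M)`. -/
def IsGFGStrategy (M : Auto A Q) (acc : Set Q → Prop) (g : List A → Q) : Prop :=
  ∀ w : ℕ → A, M.IsRun w (StrategyRun g w) ∧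
    (w ∈ M.Lang acc → acc (InfOcc (StrategyRun g w)))

/-- `M` is good for games. -/
def IsGFG (M : Auto A Q) (acc : Set Q → Prop) : Prop :=
  ∃ g : List A → Q, IsGFGStrategy M acc g

/-- `M` is unambiguous: every word of the language has exactly one accepting run. -/
def Unambiguous (M : Auto A Q) (acc : Set Q → Prop) : Prop :=
  ∀ w ∈ M.Lang acc, ∃! r : ℕ → Q, M.IsRun w r ∧ acc (InfOcc r)

/-- `M` is determinizable by pruning. -/
def DetByP (M : Auto A Q) (acc : Set Q → Prop) : Prop :=
  ∃ q0 ∈ M.init, ∃ next' : Q → A → Set Q,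
    (∀ q a, next' q a ⊆ M.next q a ∧ (next' q a).Subsingleton) ∧
    (⟨{q0}, next'⟩ : Auto A Q).Lang acc = M.Lang acc

/-- A finite-state strategy (transducer): memories `Mem`, initial memory `m0`,
memory update function `upd` and output function `out`. -/
structure Transducer (A Q Mem : Type) where
  m0 : Mem
  upd : Mem → A → Mem
  out : Mem → Q

namespace Transducer

variable (T : Transducer A Q Mem)

/-- The memory reached from `m` after reading the finite word `u`. -/
def run (m : Mem) (u : List A) : Mem := u.foldl T.upd m

/-- The strategy generated by the transducer: `u ↦ τ(ρ(m₀, u))`. -/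
def strategy : List A → Q := fun u => T.out (T.run T.m0 u)

/-- The deterministic automaton `A_g`, with initial memory replaced by `m`. -/
def autoFrom (m : Mem) : Auto A Mem := ⟨{m}, fun m' a => {T.upd m' a}⟩

/-- The deterministic automaton `A_g` itself. -/
def auto : Auto A Mem := T.autoFrom T.m0

/-- The acceptance condition `α_g` of `A_g`, obtained from `acc` by replacing each
set `F ⊆ Q` appearing in it by `{m | τ(m) ∈ F}`. -/
def accG (acc : Set Q → Prop) : Set Mem → Prop := fun S => acc (T.out '' S)

/-- `m` is reachable in `A_g` from the initial memory. -/
def Reachable (m : Mem) : Prop := ∃ u : List A, T.run T.m0 u = m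

/-- The set of memories visited along the path of `A_g` that starts at `m` and
reads the finite word `u` (both endpoints included). -/
def pathStates (m : Mem) (u : List A) : Set Mem :=
  {m' | ∃ v : List A, v <+: u ∧ T.run m v = m'}

/-- `P_{src → dst}`: the (words inducing the) finite paths of `A_g` from `src` to `dst`. -/
def PathSet (src dst : Mem) : Set (List A) :=
  {u : List A | u ≠ [] ∧ T.run src u = dst}

/-- Every combination of paths from `P_{src → dst}` satisfies `α_g`. -/
def AllCombosAcc (acc : Set Q → Prop) (src dst : Mem) : Prop :=
  ∀ S : Set (List A), S.Nonempty → S ⊆ T.PathSet src dst →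
    T.accG acc (⋃ u ∈ S, T.pathStates src u)

/-- `P_{src → dst}` is empty, or every combination of its paths satisfies `α_g`. -/
def GoodPathSet (acc : Set Q → Prop) (src dst : Mem) : Prop :=
  T.PathSet src dst = ∅ ∨ T.AllCombosAcc acc src dst

/-- `m` is replaceable by `m'`: the set `P_{m' → m}` of paths of `A_g` from `m'`
to `m` is empty, or every combination of its paths satisfies `α_g`. -/
def Replaceable (acc : Set Q → Prop) (m m' : Mem) : Prop :=
  T.GoodPathSet acc m' m

/-- The transition `(q, a, q')` is used by the strategy. -/
def Uses (q : Q) (a : A) (q' : Q) : Prop :=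
  ∃ u : List A, T.strategy u = q ∧ T.strategy (u ++ [a]) = q'

/-- The nonempty word `u` induces a cycle of `A_g` through the memory `m`. -/
def CycleThrough (m : Mem) (u : List A) : Prop := u ≠ [] ∧ T.run m u = m

/-- The cycle of `A_g` through `m` induced by `u` is accepting. -/
def AccCycle (acc : Set Q → Prop) (m : Mem) (u : List A) : Prop :=
  T.CycleThrough m u ∧ T.accG acc (T.pathStates m u)

/-- The cycle of `A_g` through `m` induced by `u` is rejecting. -/
def RejCycle (acc : Set Q → Prop) (m : Mem) (u : List A) : Prop :=
  T.CycleThrough m u ∧ ¬ T.accG acc (T.pathStates m u)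

/-- The cycle of `A_g` through `m` induced by `u` is `q`-exclusive accepting:
it is accepting, but its set of memories minus the memories of `q` is not. -/
def ExclAccCycle (acc : Set Q → Prop) (q : Q) (m : Mem) (u : List A) : Prop :=
  T.CycleThrough m u ∧ T.accG acc (T.pathStates m u) ∧
    ¬ T.accG acc (T.pathStates m u \ {m' : Mem | T.out m' = q})

end Transducer

/-- `M` is weakly tight with respect to `T`: every transition of `M` is used. -/
def WeaklyTightWrt (M : Auto A Q) (T : Transducer A Q Mem) : Prop :=
  ∀ q a q', q' ∈ M.next q a → T.Uses q a q'

/-- `M` is tight with respect to `T`: every transition of `M` is used, and no memory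
is replaceable by a different memory of the same state. -/
def TightWrt (M : Auto A Q) (acc : Set Q → Prop) (T : Transducer A Q Mem) : Prop :=
  WeaklyTightWrt M T ∧
  ∀ m m' : Mem, m ≠ m' → T.out m = T.out m' → ¬ T.Replaceable acc m m'

/-- `M` is tight: tight with respect to some finite-state strategy witnessing its GFGness. -/
def Tight (M : Auto A Q) (acc : Set Q → Prop) : Prop :=
  ∃ (Mem : Type) (_ : Fintype Mem) (T : Transducer A Q Mem),
    IsGFGStrategy M acc T.strategy ∧ TightWrt M acc T

/-- `M` is weakly tight: weakly tight with respect to some finite-state strategy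
witnessing its GFGness. -/
def WeaklyTight (M : Auto A Q) (acc : Set Q → Prop) : Prop :=
  ∃ (Mem : Type) (_ : Fintype Mem) (T : Transducer A Q Mem),
    IsGFGStrategy M acc T.strategy ∧ WeaklyTightWrt M T

/-- A Rabin automaton `M` (with pairs `(E i, F i)`) is strongly tight with respect to `T`:
tight, and every state appearing in some good set has a `q`-exclusive accepting cycle
in `A_g`. -/
def StronglyTightWrt {ι : Type} (M : Auto A Q) (E F : ι → Set Q)
    (T : Transducer A Q Mem) : Prop :=
  TightWrt M (RabinAcc E F) T ∧
  ∀ q : Q, (∃ i, q ∈ F i) →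
    ∃ (m : Mem) (u : List A), T.ExclAccCycle (RabinAcc E F) q m u

/-- A Rabin automaton is strongly tight: strongly tight with respect to some finite-state
strategy witnessing its GFGness. -/
def StronglyTight {ι : Type} (M : Auto A Q) (E F : ι → Set Q) : Prop :=
  ∃ (Mem : Type) (_ : Fintype Mem) (T : Transducer A Q Mem),
    IsGFGStrategy M (RabinAcc E F) T.strategy ∧ StronglyTightWrt M E F T

/-- One-step reachability in the transition graph of `M`. -/
def Auto.Step (M : Auto A Q) (q q' : Q) : Prop := ∃ a, q' ∈ M.next q a

/-- Reachability in the transition graph of `M`. -/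
def Auto.Reach (M : Auto A Q) : Q → Q → Prop := Relation.ReflTransGen M.Step

/-- The Büchi automaton `(M, α)` is weak: each strongly connected component is either
contained in `α` or disjoint from `α`. -/
def Auto.IsWeak (M : Auto A Q) (α : Set Q) : Prop :=
  ∀ q q', M.Reach q q' → M.Reach q' q → (q ∈ α ↔ q' ∈ α)

/-! ### Part 1: factors of sequences in a finite monoid -/

section SegPart

variable {S : Type} [Monoid S]

/-- product of the letters `t i, …, t (j-1)`. -/
def seg (t : ℕ → S) (i j : ℕ) : S := ((List.range' i (j - i)).map t).prod

lemma seg_self (t : ℕ → S) (i : ℕ) : seg t i i = 1 := by simp [seg]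

lemma seg_mul (t : ℕ → S) {i j k : ℕ} (hij : i ≤ j) (hjk : j ≤ k) :
    seg t i j * seg t j k = seg t i k := by
  unfold seg
  rw [← List.prod_append, ← List.map_append]
  congr 2
  obtain ⟨a, rfl⟩ := Nat.exists_eq_add_of_le hij
  obtain ⟨b, rfl⟩ := Nat.exists_eq_add_of_le hjk
  rw [Nat.add_sub_cancel_left, Nat.add_sub_cancel_left, List.range'_append_1]
  congr 1
  omega

lemma seg_one (t : ℕ → S) (i : ℕ) : seg t i (i + 1) = t i := by simp [seg]

lemma seg_succ (t : ℕ → S) {i j : ℕ} (hij : i ≤ j) : seg t i (j + 1) = seg t i j * t j := by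
  rw [← seg_mul t hij (Nat.le_succ j), seg_one]

/-- The loop values that occur infinitely often. -/
def Lam (t : ℕ → S) (s e : S) : Prop :=
  ∀ N, ∃ i j, N ≤ i ∧ i < j ∧ seg t 0 i = s ∧ seg t 0 j = s ∧ seg t i j = e

lemma ultra_pigeon {X : Type} [Finite X] (U : Ultrafilter ℕ) (f : ℕ → X) :
    ∃ x, ∀ᶠ i in (U : Filter ℕ), f i = x := by
  obtain ⟨x, hx⟩ := Ultrafilter.eq_pure_of_finite (U.map f)
  refine ⟨x, ?_⟩
  have : ({x} : Set X) ∈ U.map f := by rw [hx]; exact Set.mem_singleton x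
  exact this

lemma inf_pigeon {X : Type} [Finite X] (f : ℕ → X) (P : ℕ → Prop) (h : ∀ N, ∃ n, N ≤ n ∧ P n) :
    ∃ x, ∀ N, ∃ n, N ≤ n ∧ P n ∧ f n = x := by
  by_contra! hc
  choose g hg using hc
  have := Fintype.ofFinite X
  obtain ⟨n, hn, hP⟩ := h (Finset.univ.sup g)
  exact hg (f n) n (le_trans (Finset.le_sup (Finset.mem_univ _)) hn) hP rfl

lemma ramsey [Finite S] (t : ℕ → S) (s : S) (hs : ∀ N, ∃ i, N ≤ i ∧ seg t 0 i = s) :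
    ∃ f, f * f = f ∧ s * f = s ∧
      (∃ n : ℕ → ℕ, StrictMono n ∧ 0 < n 0 ∧ seg t 0 (n 0) = s ∧
        ∀ k, seg t (n k) (n (k + 1)) = f) ∧
      Lam t s f ∧ ∀ f', Lam t s f' → ∃ x y, s * x = s ∧ f = x * f' * y := by
  have hfr : ∃ᶠ i in Filter.atTop, i ∈ {i | seg t 0 i = s} := by
    rw [Filter.frequently_atTop]
    intro N
    obtain ⟨i, h1, h2⟩ := hs N
    exact ⟨i, h1, h2⟩
  rw [Filter.frequently_mem_iff_neBot] at hfr
  let U := Ultrafilter.of (Filter.atTop ⊓ Filter.principal {i | seg t 0 i = s})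
  have hU : (U : Filter ℕ) ≤ Filter.atTop ⊓ Filter.principal {i | seg t 0 i = s} :=
    Ultrafilter.of_le _
  have hU1 : ∀ N, ∀ᶠ i in (U : Filter ℕ), N ≤ i := fun N =>
    (le_trans hU inf_le_left) (Filter.eventually_ge_atTop N)
  have hU2 : ∀ᶠ i in (U : Filter ℕ), seg t 0 i = s :=
    (le_trans hU inf_le_right) (Filter.mem_principal_self _)
  choose c hc using fun i => ultra_pigeon U (fun j => seg t i j)
  obtain ⟨f, hf⟩ := ultra_pigeon U c
  -- good positions
  have good : ∀ᶠ i in (U : Filter ℕ), seg t 0 i = s ∧ c i = f := hU2.and hf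
  have next : ∀ i N, c i = f → ∃ j, N ≤ j ∧ i < j ∧ seg t i j = f ∧ seg t 0 j = s ∧ c j = f := by
    intro i N hi
    obtain ⟨j, h1, h2, h3, h4, h5⟩ :=
      ((hc i).and (good.and ((hU1 N).and (hU1 (i + 1))))).exists.imp
        (fun j h => (⟨h.1, h.2.1.1, h.2.1.2, h.2.2.1, h.2.2.2⟩ :
          seg t i j = c i ∧ seg t 0 j = s ∧ c j = f ∧ N ≤ j ∧ i + 1 ≤ j))
    exact ⟨j, h4, h5, h1.trans hi, h2, h3⟩
  obtain ⟨i0, ⟨hi0s, hi0c⟩, hi0p⟩ := (good.and (hU1 1)).exists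
  refine ⟨f, ?_, ?_, ?_, ?_, ?_⟩
  · obtain ⟨i1, -, h1, h2, h3, h4⟩ := next i0 0 hi0c
    obtain ⟨k, ⟨hk1, hk2⟩, hk3⟩ := (((hc i0).and (hc i1)).and (hU1 i1)).exists
    have := seg_mul t h1.le hk3
    rw [h2, hk1, hk2, hi0c, h4] at this
    exact this
  · obtain ⟨i1, -, h1, h2, h3, h4⟩ := next i0 0 hi0c
    have := seg_mul t (Nat.zero_le i0) h1.le
    rwa [hi0s, h2, h3] at this
  · choose g hg1 hg2 hg3 hg4 hg5 using next
    let n : ℕ → {i // c i = f} := fun k =>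
      Nat.rec ⟨i0, hi0c⟩ (fun _ p => ⟨g p.1 0 p.2, hg5 p.1 0 p.2⟩) k
    refine ⟨fun k => (n k).1, strictMono_nat_of_lt_succ fun k => hg2 (n k).1 0 (n k).2,
      hi0p, hi0s, fun k => hg3 (n k).1 0 (n k).2⟩
  · intro N
    obtain ⟨i, ⟨h1, h2⟩, h3⟩ := (good.and (hU1 N)).exists
    obtain ⟨j, -, h4, h5, h6, -⟩ := next i 0 h2
    exact ⟨i, j, h3, h4, h1, h6, h5⟩
  · intro f' hf'
    obtain ⟨i, j, h1, h2, h3, h4, h5⟩ := hf' i0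
    obtain ⟨k, h6, h7, h8, h9, -⟩ := next i0 j hi0c
    refine ⟨seg t i0 i, seg t j k, ?_, ?_⟩
    · have := seg_mul t (Nat.zero_le i0) h1
      rwa [hi0s, h3] at this
    · rw [← h5, seg_mul t h1 h2.le, seg_mul t (h1.trans h2.le) h6, h8]

/-- algebraic core -/
lemma conj_core [Finite S] {f f' x y x' y' : S} (hf : f * f = f) (hf' : f' * f' = f')
    (h1 : f = x' * f' * y') (h2 : f' = x * f * y) :
    (f * x' * f') * (f' * y' * f) = f ∧ (f' * y' * f) * (f * x' * f') = f' := by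
  have hab : (f * x' * f') * (f' * y' * f) = f := by
    calc (f * x' * f') * (f' * y' * f) = f * (x' * (f' * f') * y') * f := by simp only [mul_assoc]
      _ = f := by rw [hf', ← h1, hf, hf]
  refine ⟨hab, ?_⟩
  set a := f * x' * f' with ha
  set b := f' * y' * f with hb
  have hfa : f * a = a := by rw [ha, ← mul_assoc, ← mul_assoc, hf]
  have haf : a * f' = a := by rw [ha, mul_assoc, hf']
  have hfb : f' * b = b := by rw [hb, ← mul_assoc, ← mul_assoc, hf']
  set g := b * a with hg
  have hgg : g * g = g := by
    calc g * g = b * ((a * b) * a) := by simp only [hg, mul_assoc]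
      _ = g := by rw [hab, hfa]
  have hfg : f' * g = g := by rw [hg, ← mul_assoc, hfb]
  have hgf : g * f' = g := by rw [hg, mul_assoc, haf]
  -- f' = u g v
  have hagb : a * g * b = f := by
    calc a * g * b = (a * b) * (a * b) := by simp only [hg, mul_assoc]
      _ = f := by rw [hab, hf]
  set u := x * a
  set v := b * y
  have hu : f' = (u * g) * f' * v := by
    calc f' = x * f * y := h2
      _ = x * (a * g * b) * y := by rw [hagb]
      _ = u * (g * f') * v := by rw [hgf]; simp only [u, v, mul_assoc]
      _ = _ := by simp only [mul_assoc]
  have hpow : ∀ n : ℕ, f' = (u * g) ^ n * f' * v ^ n := by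
    intro n
    induction n with
    | zero => simp
    | succ n ih =>
      calc f' = (u * g) ^ n * f' * v ^ n := ih
        _ = (u * g) ^ n * ((u * g) * f' * v) * v ^ n := by rw [← hu]
        _ = _ := by rw [pow_succ, pow_succ']; simp only [mul_assoc]
  obtain ⟨n, m, hnm, hp⟩ : ∃ n m, n < m ∧ (u * g) ^ n = (u * g) ^ m := by
    obtain ⟨n, m, hne, h⟩ := Finite.exists_ne_map_eq_of_infinite (fun n : ℕ => (u * g) ^ n)
    rcases lt_or_gt_of_ne hne with h' | h'
    · exact ⟨n, m, h', h⟩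
    · exact ⟨m, n, h', h.symm⟩
  obtain ⟨d, rfl⟩ := Nat.exists_eq_add_of_lt hnm
  have hz : (u * g) ^ (d + 1) * f' = f' := by
    conv_lhs => rw [hpow n]
    conv_rhs => rw [hpow n, hp]
    simp only [← mul_assoc, ← pow_add]
    rw [show d + 1 + n = n + d + 1 by omega]
  have hz2 : f' = ((u * g) ^ d * u) * g := by
    calc f' = (u * g) ^ (d + 1) * f' := hz.symm
      _ = (u * g) ^ d * u * (g * f') := by rw [pow_succ]; simp only [mul_assoc]
      _ = _ := by rw [hgf]
  calc g = f' * g := hfg.symm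
    _ = ((u * g) ^ d * u) * (g * g) := by conv_lhs => rw [hz2]
                                          simp only [mul_assoc]
    _ = f' := by rw [hgg, ← hz2]

/-- Lam determines acceptance. -/
lemma lam_det [Finite S] (Acc : (ℕ → S) → Prop)
    (hG : ∀ (t : ℕ → S) (n : ℕ → ℕ), StrictMono n → n 0 = 0 →
      (Acc t ↔ Acc (fun k => seg t (n k) (n (k + 1)))))
    (t t' : ℕ → S) (hL : Lam t = Lam t') (h : Acc t) : Acc t' := by
  have key : ∀ (t : ℕ → S) (s f : S) (n : ℕ → ℕ), StrictMono n → 0 < n 0 → seg t 0 (n 0) = s →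
      (∀ k, seg t (n k) (n (k + 1)) = f) →
      (Acc t ↔ Acc (fun k => if k = 0 then s else f)) := by
    intro t s f n hn h0 hs hf
    rw [hG t (fun k => Nat.casesOn k 0 n) _ rfl]
    · have : (fun k => seg t (Nat.casesOn k 0 n : ℕ) (Nat.casesOn (k+1) 0 n : ℕ)) =
        (fun k => if k = 0 then s else f) := by
        funext k
        cases k with
        | zero => simpa using hs
        | succ k => simpa using hf k
      exact iff_of_eq (congrArg Acc this)
    · apply strictMono_nat_of_lt_succ
      intro k
      cases k with
      | zero => exact h0
      | succ k => exact hn (Nat.lt_succ_self k)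
  obtain ⟨s, hs⟩ := inf_pigeon (fun i => seg t 0 i) (fun _ => True) (fun N => ⟨N, le_rfl, trivial⟩)
  obtain ⟨f, hff, hsf, ⟨n, hn, hn0, hns, hnf⟩, hlf, hall⟩ :=
    ramsey t s (fun N => (hs N).imp fun i h => ⟨h.1, h.2.2⟩)
  have hs' : ∀ N, ∃ i, N ≤ i ∧ seg t' 0 i = s := by
    intro N
    rw [hL] at hlf
    obtain ⟨i, j, h1, h2, h3, h4⟩ := hlf N
    exact ⟨i, h1, h3⟩
  obtain ⟨f', hff', hsf', ⟨n', hn', hn0', hns', hnf'⟩, hlf', hall'⟩ := ramsey t' s hs'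
  rw [hL] at hall hlf
  obtain ⟨x', y', hx', h1⟩ := hall f' hlf'
  obtain ⟨x, y, hx, h2⟩ := hall' f hlf
  obtain ⟨hab, hba⟩ := conj_core hff hff' h1 h2
  set a := f * x' * f'
  set b := f' * y' * f
  have hsa : s * a = s := by simp only [a, ← mul_assoc]; rw [hsf, hx', hsf']
  rw [key t s f n hn hn0 hns hnf] at h
  rw [key t' s f' n' hn' hn0' hns' hnf']
  let τ : ℕ → S := fun k => if k = 0 then s else if k % 2 = 1 then a else b
  have k1 := key τ s f (fun k => 2 * k + 1) (strictMono_nat_of_lt_succ fun k => by omega)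
    (by norm_num) (by simp [seg, τ]) (by
      intro k
      show seg τ (2 * k + 1) (2 * (k + 1) + 1) = f
      rw [show 2 * (k + 1) + 1 = (2 * k + 1) + 1 + 1 by ring, seg_succ _ (by omega), seg_one]
      have e1 : (2 * k + 1) % 2 = 1 := by omega
      have e2 : ¬ (2 * k + 1 + 1) % 2 = 1 := by omega
      simp only [τ]
      rw [if_neg (by omega), if_pos e1, if_neg (by omega), if_neg e2, hab])
  have k2 := key τ s f' (fun k => 2 * k + 2) (strictMono_nat_of_lt_succ fun k => by omega)
    (by norm_num) (by
      show seg τ 0 (0 + 1 + 1) = s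
      rw [seg_succ _ (by omega), seg_one]; simp [τ, hsa]) (by
      intro k
      show seg τ (2 * k + 2) (2 * (k + 1) + 2) = f'
      rw [show 2 * (k + 1) + 2 = (2 * k + 2) + 1 + 1 by ring, seg_succ _ (by omega), seg_one]
      have e1 : ¬ (2 * k + 2) % 2 = 1 := by omega
      have e2 : (2 * k + 2 + 1) % 2 = 1 := by omega
      simp only [τ]
      rw [if_neg (by omega), if_neg e1, if_neg (by omega), if_pos e2, hba])
  exact k2.1 (k1.2 h)

end SegPart

/-! ### Part 2: the deterministic automaton observing `Lam` -/

section DetPart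

lemma image_infOcc {X Y : Type} [Finite X] (f : X → Y) (r : ℕ → X) :
    f '' InfOcc r = InfOcc (fun n => f (r n)) := by
  ext y
  constructor
  · rintro ⟨x, hx, rfl⟩ N
    obtain ⟨m, h1, h2⟩ := hx N
    exact ⟨m, h1, congrArg f h2⟩
  · intro hy
    obtain ⟨x, hx⟩ := inf_pigeon r (fun n => f (r n) = y) hy
    refine ⟨x, fun N => ?_, ?_⟩
    · obtain ⟨n, h1, h2, h3⟩ := hx N
      exact ⟨n, h1, h3⟩
    · obtain ⟨n, h1, h2, h3⟩ := hx 0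
      rw [← h3]; exact h2

lemma infOcc_late {X : Type} [Finite X] (r : ℕ → X) : ∃ N, ∀ n, N ≤ n → r n ∈ InfOcc r := by
  by_contra! hc
  obtain ⟨x, hx⟩ := inf_pigeon r (fun n => r n ∉ InfOcc r)
    (fun N => by obtain ⟨n, h1, h2⟩ := hc N; exact ⟨n, h1, h2⟩)
  obtain ⟨n, -, h1, h2⟩ := hx 0
  apply h1
  intro N
  obtain ⟨m, h3, -, h4⟩ := hx N
  exact ⟨m, h3, h4.trans h2.symm⟩

/-- states of the observer -/
abbrev DSt (S : Type) := S × (S → S → Set S) × (S → S → Prop)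

variable {S : Type} [Monoid S]

/-- pending set after one letter -/
def dPend (x : DSt S) (c : S) (s e : S) : Set S :=
  {y | ∃ z, ((z ∈ x.2.1 s e ∧ ¬ x.2.2 s e) ∨ (x.1 = s ∧ z = 1)) ∧ y = z * c}

/-- update of the observer -/
def dUpd (x : DSt S) (c : S) : DSt S :=
  (x.1 * c, dPend x c, fun s e => x.1 * c = s ∧ e ∈ dPend x c s e)

/-- initial state of the observer -/
def dInit : DSt S := (1, fun _ _ => ∅, fun _ _ => False)

/-- run of the observer -/
def dRun (t : ℕ → S) : ℕ → DSt S
  | 0 => dInit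
  | n + 1 => dUpd (dRun t n) (t n)

lemma dRun_fst (t : ℕ → S) (n : ℕ) : (dRun t n).1 = seg t 0 n := by
  induction n with
  | zero => simp [dRun, dInit, seg]
  | succ n ih => rw [seg_succ t (Nat.zero_le n), ← ih]; rfl

lemma dRun_pend (t : ℕ → S) (s e : S) (n : ℕ) (y : S) : y ∈ (dRun t n).2.1 s e ↔
    ∃ i, i < n ∧ seg t 0 i = s ∧ seg t i n = y ∧ ∀ m, i < m → m < n → ¬ (dRun t m).2.2 s e := by
  induction n generalizing y with
  | zero => simp [dRun, dInit]
  | succ n ih =>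
    show (∃ z, ((z ∈ (dRun t n).2.1 s e ∧ ¬ (dRun t n).2.2 s e) ∨ ((dRun t n).1 = s ∧ z = 1)) ∧
      y = z * t n) ↔ _
    constructor
    · rintro ⟨z, ⟨hz, hfl⟩ | ⟨hs, rfl⟩, rfl⟩
      · obtain ⟨i, h1, h2, h3, h4⟩ := (ih z).1 hz
        refine ⟨i, by omega, h2, by rw [seg_succ t h1.le, h3], ?_⟩
        intro m hm1 hm2
        rcases Nat.lt_succ_iff_lt_or_eq.1 hm2 with h | rfl
        · exact h4 m hm1 h
        · exact hfl
      · refine ⟨n, by omega, by rw [← dRun_fst, hs], by rw [seg_one, one_mul], ?_⟩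
        intro m h1 h2
        omega
    · rintro ⟨i, h1, h2, h3, h4⟩
      rcases Nat.lt_succ_iff_lt_or_eq.1 h1 with h | rfl
      · refine ⟨seg t i n, Or.inl ⟨(ih _).2 ⟨i, h, h2, rfl, fun m hm1 hm2 => h4 m hm1 (by omega)⟩,
          h4 n h (by omega)⟩, ?_⟩
        rw [← h3, seg_succ t h.le]
      · exact ⟨1, Or.inr ⟨by rw [dRun_fst, h2], rfl⟩, by rw [← h3, seg_one, one_mul]⟩

lemma dRun_flag (t : ℕ → S) (s e : S) (n : ℕ) : (dRun t n).2.2 s e ↔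
    seg t 0 n = s ∧ e ∈ (dRun t n).2.1 s e := by
  cases n with
  | zero => simp [dRun, dInit]
  | succ n =>
    rw [← dRun_fst]
    rfl

lemma lam_iff [Finite S] (t : ℕ → S) (s e : S) :
    Lam t s e ↔ ∃ x ∈ InfOcc (dRun t), x.2.2 s e := by
  have h1 : Lam t s e ↔ ∀ N, ∃ n, N ≤ n ∧ (dRun t n).2.2 s e := by
    constructor
    · intro h N
      obtain ⟨i, j, h1, h2, h3, h4, h5⟩ := h N
      by_cases hc : ∃ m, i < m ∧ m < j ∧ (dRun t m).2.2 s e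
      · obtain ⟨m, h6, h7, h8⟩ := hc
        exact ⟨m, by omega, h8⟩
      · push Not at hc
        exact ⟨j, by omega, (dRun_flag t s e j).2 ⟨h4, (dRun_pend t s e j e).2
          ⟨i, h2, h3, h5, hc⟩⟩⟩
    · intro h N
      obtain ⟨m1, h1, h2⟩ := h N
      obtain ⟨m2, h3, h4⟩ := h (m1 + 1)
      obtain ⟨h5, h6⟩ := (dRun_flag t s e m2).1 h4
      obtain ⟨i, h7, h8, h9, h10⟩ := (dRun_pend t s e m2 e).1 h6
      refine ⟨i, m2, ?_, h7, h8, h5, h9⟩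
      by_contra hlt
      exact h10 m1 (by omega) (by omega) h2
  rw [h1]
  constructor
  · intro h
    obtain ⟨x, hx⟩ := inf_pigeon (dRun t) _ h
    refine ⟨x, fun N => ?_, ?_⟩
    · obtain ⟨n, a, b, c⟩ := hx N
      exact ⟨n, a, c⟩
    · obtain ⟨n, a, b, c⟩ := hx 0
      rw [← c]; exact b
  · rintro ⟨x, hx, hf⟩ N
    obtain ⟨m, a, b⟩ := hx N
    exact ⟨m, a, by rw [b]; exact hf⟩

end DetPart

/-! ### Part 3: profiles -/

section ProfPart

/-- profiles of finite words -/
def Prof (Q : Type) : Type := Q → Q → Set (Set Q)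

lemma Prof.ext' {x y : Prof Q} (h : ∀ p q V, V ∈ x p q ↔ V ∈ y p q) : x = y := by
  funext p q
  exact Set.ext (h p q)

instance [Finite Q] : Finite (Prof Q) := by unfold Prof; infer_instance

/-- composition of profiles -/
def Prof.comp (x y : Prof Q) : Prof Q :=
  fun p q => {V | ∃ r V1 V2, V1 ∈ x p r ∧ V2 ∈ y r q ∧ V = V1 ∪ V2}

/-- identity profile -/
def Prof.id : Prof Q := fun p q => {V | p = q ∧ V = ∅}

instance : Monoid (Prof Q) where
  mul := Prof.comp
  one := Prof.id
  mul_assoc x y z := by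
    apply Prof.ext'
    intro p q V
    constructor
    · rintro ⟨r, V1, V2, ⟨r', W1, W2, h1, h2, rfl⟩, h3, rfl⟩
      exact ⟨r', W1, W2 ∪ V2, h1, ⟨r, W2, V2, h2, h3, rfl⟩, Set.union_assoc _ _ _⟩
    · rintro ⟨r, V1, V2, h1, ⟨r', W1, W2, h2, h3, rfl⟩, rfl⟩
      exact ⟨r', V1 ∪ W1, W2, ⟨r, V1, W1, h1, h2, rfl⟩, h3, (Set.union_assoc _ _ _).symm⟩
  one_mul x := by
    apply Prof.ext'
    intro p q V
    constructor
    · rintro ⟨r, V1, V2, ⟨rfl, rfl⟩, h3, rfl⟩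
      rwa [Set.empty_union]
    · intro h
      exact ⟨p, ∅, V, ⟨rfl, rfl⟩, h, (Set.empty_union V).symm⟩
  mul_one x := by
    apply Prof.ext'
    intro p q V
    constructor
    · rintro ⟨r, V1, V2, h3, ⟨rfl, rfl⟩, rfl⟩
      rwa [Set.union_empty]
    · intro h
      exact ⟨q, V, ∅, h, ⟨rfl, rfl⟩, (Set.union_empty V).symm⟩

/-- acceptance of sequences of profiles -/
def PAcc (I : Set Q) (acc : Set Q → Prop) (t : ℕ → Prof Q) : Prop :=
  ∃ (q : ℕ → Q) (V : ℕ → Set Q), q 0 ∈ I ∧ (∀ i, V i ∈ t i (q i) (q (i + 1))) ∧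
    acc {p | ∀ N, ∃ m, N ≤ m ∧ p ∈ V m}

lemma mem_seg (t : ℕ → Prof Q) {i j : ℕ} (hij : i ≤ j) (p q : Q) (V : Set Q) :
    V ∈ seg t i j p q ↔ ∃ (ρ : ℕ → Q) (U : ℕ → Set Q), ρ i = p ∧ ρ j = q ∧
      (∀ m, i ≤ m → m < j → U m ∈ t m (ρ m) (ρ (m + 1))) ∧
      V = {x | ∃ m, i ≤ m ∧ m < j ∧ x ∈ U m} := by
  induction j, hij using Nat.le_induction generalizing q V with
  | base =>
    rw [seg_self]
    show (p = q ∧ V = ∅) ↔ _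
    constructor
    · rintro ⟨rfl, rfl⟩
      refine ⟨fun _ => p, fun _ => ∅, rfl, rfl, fun m _ _ => by omega, ?_⟩
      ext x; simp
    · rintro ⟨ρ, U, rfl, rfl, -, rfl⟩
      refine ⟨rfl, ?_⟩
      ext x
      simp only [Set.mem_ofPred_eq, Set.mem_empty_iff_false, iff_false]
      rintro ⟨m, h1, h2, -⟩
      omega
  | succ j hij ih =>
    rw [seg_succ t hij]
    show (∃ r V1 V2, V1 ∈ seg t i j p r ∧ V2 ∈ t j r q ∧ V = V1 ∪ V2) ↔ _
    constructor
    · rintro ⟨r, V1, V2, h1, h2, rfl⟩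
      obtain ⟨ρ, U, rfl, rfl, h3, rfl⟩ := (ih _ _).1 h1
      refine ⟨fun m => if m ≤ j then ρ m else q, fun m => if m < j then U m else V2,
        by simp [hij], by simp, ?_, ?_⟩
      · intro m h4 h5
        rcases Nat.lt_succ_iff_lt_or_eq.1 h5 with h | rfl
        · have e1 : m ≤ j := h.le
          have e2 : m + 1 ≤ j := h
          simp only [if_pos h, if_pos e1, if_pos e2]
          exact h3 m h4 h
        · simpa using h2
      · ext x
        constructor
        · rintro (⟨m, h4, h5, h6⟩ | h)
          · exact ⟨m, h4, by omega, by simpa [h5] using h6⟩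
          · exact ⟨j, hij, by omega, by simpa using h⟩
        · rintro ⟨m, h4, h5, h6⟩
          by_cases h : m < j
          · exact Or.inl ⟨m, h4, h, by simpa [h] using h6⟩
          · exact Or.inr (by simpa [h] using h6)
    · rintro ⟨ρ, U, rfl, rfl, h3, rfl⟩
      refine ⟨ρ j, _, U j, (ih _ _).2 ⟨ρ, U, rfl, rfl, fun m h1 h2 => h3 m h1 (by omega), rfl⟩,
        h3 j hij (by omega), ?_⟩
      ext x
      constructor
      · rintro ⟨m, h4, h5, h6⟩
        rcases Nat.lt_succ_iff_lt_or_eq.1 h5 with h | rfl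
        · exact Or.inl ⟨m, h4, h, h6⟩
        · exact Or.inr h6
      · rintro (⟨m, h4, h5, h6⟩ | h)
        · exact ⟨m, h4, by omega, h6⟩
        · exact ⟨j, hij, by omega, h⟩

lemma exists_block (n : ℕ → ℕ) (hn : StrictMono n) (h0 : n 0 = 0) (m : ℕ) :
    ∃ k, n k ≤ m ∧ m < n (k + 1) := by
  induction m with
  | zero => exact ⟨0, by omega, by have := hn (Nat.lt_add_one 0); omega⟩
  | succ m ih =>
    obtain ⟨k, h1, h2⟩ := ih
    by_cases h : m + 1 < n (k + 1)
    · exact ⟨k, by omega, h⟩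
    · exact ⟨k + 1, by omega, by have := hn (Nat.lt_add_one (k + 1)); omega⟩

lemma block_unique (n : ℕ → ℕ) (hn : StrictMono n) {m k l : ℕ} (h1 : n k ≤ m)
    (h2 : m < n (k + 1)) (h3 : n l ≤ m) (h4 : m < n (l + 1)) : k = l := by
  have a := hn.lt_iff_lt.1 (h1.trans_lt h4)
  have b := hn.lt_iff_lt.1 (h3.trans_lt h2)
  omega

lemma pAcc_group (I : Set Q) (acc : Set Q → Prop) (t : ℕ → Prof Q) (n : ℕ → ℕ)
    (hn : StrictMono n) (h0 : n 0 = 0) :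
    PAcc I acc t ↔ PAcc I acc (fun k => seg t (n k) (n (k + 1))) := by
  have hlt : ∀ k, n k < n (k + 1) := fun k => hn (Nat.lt_succ_self k)
  choose idx hidx1 hidx2 using exists_block n hn h0
  have hsets : ∀ (U V : ℕ → Set Q),
      (∀ k, V k = {x | ∃ m, n k ≤ m ∧ m < n (k + 1) ∧ x ∈ U m}) →
      {p | ∀ N, ∃ m, N ≤ m ∧ p ∈ V m} = {p | ∀ N, ∃ m, N ≤ m ∧ p ∈ U m} := by
    intro U V hV
    ext p
    constructor
    · intro h N
      obtain ⟨k, h1, h2⟩ := h N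
      rw [hV] at h2
      obtain ⟨m, h3, h4, h5⟩ := h2
      exact ⟨m, by have := hn.le_apply (x := k); omega, h5⟩
    · intro h N
      obtain ⟨m, h1, h2⟩ := h (n N)
      refine ⟨idx m, ?_, ?_⟩
      · have := hn.lt_iff_lt.1 (h1.trans_lt (hidx2 m))
        omega
      · rw [hV]
        exact ⟨m, hidx1 m, hidx2 m, h2⟩
  constructor
  · rintro ⟨q, U, hq, hU, ha⟩
    refine ⟨fun k => q (n k), fun k => {x | ∃ m, n k ≤ m ∧ m < n (k + 1) ∧ x ∈ U m},
      by show q (n 0) ∈ I; rw [h0]; exact hq, ?_, ?_⟩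
    · intro k
      exact (mem_seg t (hlt k).le _ _ _).2 ⟨q, U, rfl, rfl, fun m _ _ => hU m, rfl⟩
    · rw [hsets U _ (fun _ => rfl)]
      exact ha
  · rintro ⟨q, V, hq, hV, ha⟩
    choose ρ U h1 h2 h3 h4 using fun k => (mem_seg t (hlt k).le _ _ _).1 (hV k)
    have hid : ∀ k m, n k ≤ m → m < n (k + 1) → idx m = k := fun k m a b =>
      block_unique n hn (hidx1 m) (hidx2 m) a b
    refine ⟨fun m => ρ (idx m) m, fun m => U (idx m) m, ?_, ?_, ?_⟩
    · have : idx 0 = 0 := hid 0 0 (by omega) (by have := hlt 0; omega)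
      have h := h1 0
      rw [h0] at h
      simp only [this, h]
      exact hq
    · intro m
      have h := h3 (idx m) m (hidx1 m) (hidx2 m)
      have e : ρ (idx (m + 1)) (m + 1) = ρ (idx m) (m + 1) := by
        by_cases hc : m + 1 < n (idx m + 1)
        · rw [hid (idx m) (m + 1) (by have := hidx1 m; omega) hc]
        · have e1 : m + 1 = n (idx m + 1) := by have := hidx2 m; omega
          have e2 : idx (m + 1) = idx m + 1 :=
            hid _ _ (by omega) (by rw [e1]; exact hlt _)
          rw [e2, e1, h1, h2]
      simp only [e]
      exact h
    · rw [← hsets (fun m => U (idx m) m) V]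
      · exact ha
      · intro k
        rw [h4 k]
        ext x
        constructor
        · rintro ⟨m, a, b, c⟩
          exact ⟨m, a, b, by rw [hid k m a b]; exact c⟩
        · rintro ⟨m, a, b, c⟩
          rw [hid k m a b] at c
          exact ⟨m, a, b, c⟩

/-- profile of a letter -/
def letterProf (M : Auto A Q) (a : A) : Prof Q := fun p q => {V | q ∈ M.next p a ∧ V = {q}}

lemma lang_iff (M : Auto A Q) (acc : Set Q → Prop) (w : ℕ → A) :
    w ∈ M.Lang acc ↔ PAcc M.init acc (fun i => letterProf M (w i)) := by
  have hs : ∀ q : ℕ → Q, {p | ∀ N, ∃ m, N ≤ m ∧ p ∈ ({q (m + 1)} : Set Q)} = InfOcc q := by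
    intro q
    ext p
    constructor
    · intro h N
      obtain ⟨m, h1, h2⟩ := h N
      exact ⟨m + 1, by omega, h2.symm⟩
    · intro h N
      obtain ⟨m, h1, h2⟩ := h (N + 1)
      refine ⟨m - 1, by omega, ?_⟩
      rw [show m - 1 + 1 = m by omega]
      exact h2.symm
  constructor
  · rintro ⟨r, ⟨h1, h2⟩, h3⟩
    refine ⟨r, fun i => {r (i + 1)}, h1, fun i => ⟨h2 i, rfl⟩, ?_⟩
    rw [hs]; exact h3
  · rintro ⟨q, V, h1, h2, h3⟩
    refine ⟨q, ⟨h1, fun i => (h2 i).1⟩, ?_⟩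
    rw [← hs]
    have : V = fun m => {q (m + 1)} := funext fun i => (h2 i).2
    rw [this] at h3
    exact h3

/-- McNaughton: the language is determined by `Inf` of a finite deterministic automaton. -/
lemma mcnaughton [Finite Q] (M : Auto A Q) (acc : Set Q → Prop) :
    ∃ (X : Type) (_ : Finite X) (x0 : X) (upd : X → A → X) (F : Set X → Prop),
      ∀ (w : ℕ → A) (x : ℕ → X), x 0 = x0 → (∀ n, x (n + 1) = upd (x n) (w n)) →
        (w ∈ M.Lang acc ↔ F (InfOcc x)) := by
  refine ⟨DSt (Prof Q), inferInstance, dInit, fun x a => dUpd x (letterProf M a),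
    fun I => ∃ w ∈ M.Lang acc, InfOcc (dRun fun i => letterProf M (w i)) = I, ?_⟩
  intro w x hx0 hx
  have hxr : x = dRun fun i => letterProf M (w i) := by
    funext n
    induction n with
    | zero => exact hx0
    | succ n ih => rw [hx, ih]; rfl
  rw [hxr]
  constructor
  · intro h
    exact ⟨w, h, rfl⟩
  · rintro ⟨w', hw', hI⟩
    rw [lang_iff] at hw' ⊢
    refine lam_det (PAcc M.init acc) (pAcc_group M.init acc) _ _ ?_ hw'
    funext s e
    apply propext
    rw [lam_iff, lam_iff, hI]

end ProfPart

/-! ### Part 4: latest appearance records -/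

section LarPart

/-- the liminf of the priorities is not odd -/
def ParOK (c : ℕ → ℕ) : Prop :=
  ∀ k, Odd k → ¬ ((∃ N, ∀ n, N ≤ n → k ≤ c n) ∧ ∀ N, ∃ n, N ≤ n ∧ c n = k)

/-- states enriched with a latest appearance record -/
abbrev LSt (V : Type) := V × (V → V → Prop) × Set V

open Classical in
/-- priority of a record -/
noncomputable def larPrio {V : Type} (W : Set V → Prop) (x : LSt V) : ℕ :=
  2 * (Nat.card V - x.2.2.ncard) + if W x.2.2 then 0 else 1

/-- one step of the record -/
def LarStep {V : Type} (x y : LSt V) : Prop :=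
  (∀ v w, y.2.1 v w ↔ (v = y.1 ∨ (w ≠ y.1 ∧ x.2.1 v w))) ∧ y.2.2 = {v | x.2.1 v y.1}

lemma lar_char {V : Type} (x : ℕ → LSt V)
    (h0 : ∀ v w, (x 0).2.1 v w ↔ ((x 0).1 = w → (x 0).1 = v))
    (hs : ∀ n, LarStep (x n) (x (n + 1))) (n : ℕ) (v w : V) :
    (x n).2.1 v w ↔ ∀ k, k ≤ n → (x k).1 = w → ∃ j, k ≤ j ∧ j ≤ n ∧ (x j).1 = v := by
  induction n generalizing v w with
  | zero =>
    rw [h0]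
    constructor
    · intro h k hk hw
      obtain rfl : k = 0 := by omega
      exact ⟨0, le_rfl, le_rfl, h hw⟩
    · intro h hw
      obtain ⟨j, -, hj, hv⟩ := h 0 le_rfl hw
      obtain rfl : j = 0 := by omega
      exact hv
  | succ n ih =>
    rw [(hs n).1]
    constructor
    · rintro (rfl | ⟨h1, h2⟩) k hk hw
      · exact ⟨n + 1, hk, le_rfl, rfl⟩
      · have hk' : k ≠ n + 1 := by
          rintro rfl
          exact h1 hw.symm
        obtain ⟨j, a, b, c⟩ := (ih v w).1 h2 k (by omega) hw
        exact ⟨j, a, by omega, c⟩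
    · intro h
      by_cases hv : v = (x (n + 1)).1
      · exact Or.inl hv
      · refine Or.inr ⟨?_, (ih v w).2 ?_⟩
        · intro hw
          obtain ⟨j, a, b, c⟩ := h (n + 1) le_rfl hw.symm
          obtain rfl : j = n + 1 := by omega
          exact hv c.symm
        · intro k hk hw
          obtain ⟨j, a, b, c⟩ := h k (by omega) hw
          refine ⟨j, a, ?_, c⟩
          by_contra hj
          obtain rfl : j = n + 1 := by omega
          exact hv c.symm

lemma lar_inf {V : Type} [Finite V] (x : ℕ → LSt V)
    (h0 : ∀ v w, (x 0).2.1 v w ↔ ((x 0).1 = w → (x 0).1 = v))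
    (hs : ∀ n, LarStep (x n) (x (n + 1))) :
    (∃ N, ∀ n, N ≤ n → (x n).2.2 ⊆ InfOcc (fun n => (x n).1)) ∧
    (∀ N, ∃ n, N ≤ n ∧ (x n).2.2 = InfOcc (fun n => (x n).1)) := by
  have hch := lar_char x h0 hs
  set r : ℕ → V := fun n => (x n).1 with hr
  obtain ⟨N1, hN1⟩ := infOcc_late r
  have hvis : ∃ N2, ∀ v ∈ InfOcc r, ∃ k, N1 ≤ k ∧ k ≤ N2 ∧ r k = v := by
    have : ∀ v : V, ∃ k, v ∈ InfOcc r → N1 ≤ k ∧ r k = v := by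
      intro v
      by_cases hv : v ∈ InfOcc r
      · obtain ⟨k, a, b⟩ := hv N1
        exact ⟨k, fun _ => ⟨a, b⟩⟩
      · exact ⟨0, fun h => absurd h hv⟩
    choose g hg using this
    have := Fintype.ofFinite V
    exact ⟨Finset.univ.sup g, fun v hv =>
      ⟨g v, (hg v hv).1, Finset.le_sup (Finset.mem_univ v), (hg v hv).2⟩⟩
  obtain ⟨N2, hN2⟩ := hvis
  have hsub : ∀ n, max N1 N2 + 1 ≤ n → (x n).2.2 ⊆ InfOcc r := by
    intro n hn v hv
    obtain ⟨n, rfl⟩ : ∃ m, n = m + 1 := ⟨n - 1, by omega⟩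
    rw [(hs n).2] at hv
    obtain ⟨k, a, b, c⟩ := hN2 (r (n + 1)) (hN1 _ (by omega))
    obtain ⟨j, d, e, f⟩ := (hch n v _).1 hv k (by omega) c
    rw [← f]
    exact hN1 j (by omega)
  refine ⟨⟨_, hsub⟩, ?_⟩
  intro N0
  set N := max N0 (max N1 N2 + 1) with hN
  have hne : (InfOcc r).Nonempty := ⟨_, hN1 N1 le_rfl⟩
  classical
  obtain ⟨z, hz, hmin⟩ := Set.exists_min_image (InfOcc r)
    (fun v => Nat.findGreatest (fun k => r k = v) N) (Set.toFinite _) hne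
  obtain ⟨m, hm1, hm2⟩ : ∃ m, r (N + 1 + m) = z ∧ ∀ l, l < m → r (N + 1 + l) ≠ z := by
    have hex : ∃ m, r (N + 1 + m) = z := by
      obtain ⟨m, a, b⟩ := hz (N + 1)
      exact ⟨m - (N + 1), by rw [show N + 1 + (m - (N + 1)) = m by omega]; exact b⟩
    exact ⟨Nat.find hex, Nat.find_spec hex, fun l hl => Nat.find_min hex hl⟩
  refine ⟨N + m + 1, by omega, Set.Subset.antisymm (hsub _ (by omega)) ?_⟩
  intro v hv
  rw [(hs (N + m)).2]
  show (x (N + m)).2.1 v (r (N + m + 1))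
  rw [hch, show N + m + 1 = N + 1 + m by omega, hm1]
  intro k hk hkz
  have hkN : k ≤ N := by
    by_contra hlt
    exact hm2 (k - (N + 1)) (by omega) (by rw [show N + 1 + (k - (N + 1)) = k by omega]; exact hkz)
  have e1 : k ≤ Nat.findGreatest (fun k => r k = z) N := Nat.le_findGreatest hkN hkz
  have e2 := hmin v hv
  obtain ⟨l, a, b, c⟩ := hN2 v hv
  have e3 : r (Nat.findGreatest (fun k => r k = v) N) = v :=
    Nat.findGreatest_spec (P := fun k => r k = v) (m := l) (by omega) c
  exact ⟨_, e1.trans e2, (Nat.findGreatest_le N).trans (by omega), e3⟩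

lemma lar_parity {V : Type} [Finite V] (W : Set V → Prop) (x : ℕ → LSt V)
    (h0 : ∀ v w, (x 0).2.1 v w ↔ ((x 0).1 = w → (x 0).1 = v))
    (hs : ∀ n, LarStep (x n) (x (n + 1))) :
    ParOK (fun n => larPrio W (x n)) ↔ W (InfOcc (fun n => (x n).1)) := by
  obtain ⟨⟨N, hsub⟩, heq⟩ := lar_inf x h0 hs
  set I := InfOcc (fun n => (x n).1)
  have hle : ∀ s : Set V, s.ncard ≤ Nat.card V := fun s => by
    rw [← Set.ncard_univ]; exact Set.ncard_le_ncard (Set.subset_univ s)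
  have hI := hle I
  constructor
  · intro h
    by_contra hW
    refine h (2 * (Nat.card V - I.ncard) + 1) ⟨_, rfl⟩ ⟨⟨N, fun n hn => ?_⟩, fun N' => ?_⟩
    · rcases (hsub n hn).eq_or_ssubset with h1 | h1
      · simp [larPrio, h1, hW]
      · have := Set.ncard_lt_ncard h1
        have := hle (x n).2.2
        simp only [larPrio]
        omega
    · obtain ⟨n, a, b⟩ := heq N'
      exact ⟨n, a, by simp [larPrio, b, hW]⟩
  · rintro hW k hk ⟨⟨N', h1⟩, h2⟩
    obtain ⟨n, a, b⟩ := heq N'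
    have h3 : k ≤ larPrio W (x n) := h1 n a
    rw [larPrio, if_pos (by rw [b]; exact hW), b] at h3
    obtain ⟨m, c, d⟩ := h2 N
    have h4 := Set.ncard_le_ncard (hsub m c)
    have h5 := hle (x m).2.2
    simp only [larPrio] at d
    obtain ⟨l, rfl⟩ := hk
    omega

end LarPart

/-! ### Part 5: positional strategies for parity conditions -/

section PosPart

lemma prefixWord_succ (w : ℕ → A) (n : ℕ) : prefixWord w (n + 1) = prefixWord w n ++ [w n] := by
  simp [prefixWord, List.range_succ]

lemma prefixWord_length (w : ℕ → A) (n : ℕ) : (prefixWord w n).length = n := by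
  simp [prefixWord]

/-- descents for priority `k` -/
def Desc (c : List A → ℕ) (k : ℕ) (v u : List A) : Prop :=
  ∃ x, x ≠ [] ∧ v = u ++ x ∧ c v = k ∧ ∀ y, y ≠ [] → y <+: x → k ≤ c (u ++ y)

lemma desc_wf (c : List A → ℕ) (hc : ∀ w : ℕ → A, ParOK (fun n => c (prefixWord w n)))
    (k : ℕ) (hk : Odd k) : WellFounded (Desc c k) := by
  rw [wellFounded_iff_isEmpty_descending_chain]
  refine ⟨fun ⟨u, hu⟩ => ?_⟩
  choose x hx0 hx1 hx2 hx3 using hu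
  have hlen : ∀ n, (u n).length < (u (n + 1)).length := by
    intro n
    have := List.length_pos_of_ne_nil (hx0 n)
    rw [hx1 n, List.length_append]
    omega
  have hmono : StrictMono (fun n => (u n).length) := strictMono_nat_of_lt_succ hlen
  have hpre : ∀ i j, i ≤ j → u i <+: u j := by
    intro i j hij
    induction j, hij using Nat.le_induction with
    | base => exact List.prefix_rfl
    | succ j _ ih => exact ih.trans (by rw [hx1 j]; exact List.prefix_append _ _)
  have hw : ∀ m, ∃ a, (u (m + 1))[m]? = some a := by
    intro m
    have := hmono.le_apply (x := m + 1)
    exact ⟨_, List.getElem?_eq_getElem (show m < (u (m + 1)).length by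
      omega)⟩
  choose w hw using hw
  have hget : ∀ i m, m < (u i).length → (u i)[m]? = some (w m) := by
    intro i m hm
    rw [← hw m]
    have hm' : m < (u (m + 1)).length := by
      have := hmono.le_apply (x := m + 1)
      omega
    rcases le_total i (m + 1) with h | h
    · obtain ⟨z, hz⟩ := hpre _ _ h
      rw [← hz, List.getElem?_append_left hm]
    · obtain ⟨z, hz⟩ := hpre _ _ h
      rw [← hz, List.getElem?_append_left hm']
  have hpw : ∀ i n, n ≤ (u i).length → prefixWord w n = (u i).take n := by
    intro i n hn
    apply List.ext_getElem?
    intro m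
    by_cases hm : m < n
    · rw [List.getElem?_take_of_lt hm, hget i m (by omega)]
      simp [prefixWord, hm]
    · rw [List.getElem?_eq_none (by rw [prefixWord_length]; omega),
        List.getElem?_eq_none (by rw [List.length_take]; omega)]
  refine hc w k hk ⟨⟨(u 0).length + 1, fun n hn => ?_⟩, fun N => ?_⟩
  · have hex : ∃ i, n ≤ (u i).length := ⟨n, hmono.le_apply⟩
    classical
    obtain ⟨i, hi1, hi2⟩ : ∃ i, n ≤ (u (i + 1)).length ∧ (u i).length < n := by
      have h1 := Nat.find_spec hex
      have h2 : Nat.find hex ≠ 0 := by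
        intro h0
        rw [h0] at h1
        omega
      refine ⟨Nat.find hex - 1, ?_, ?_⟩
      · rw [show Nat.find hex - 1 + 1 = Nat.find hex by omega]; exact h1
      · have := Nat.find_min hex (m := Nat.find hex - 1) (by omega)
        omega
    show k ≤ c (prefixWord w n)
    rw [hpw (i + 1) n hi1, hx1 i, List.take_append, List.take_of_length_le hi2.le]
    apply hx3 i
    · apply List.ne_nil_of_length_pos
      rw [hx1 i, List.length_append] at hi1
      rw [List.length_take]
      omega
    · exact List.take_prefix _ _
  · refine ⟨(u (N + 1)).length, ?_, ?_⟩
    · have := hmono.le_apply (x := N + 1)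
      omega
    · show c (prefixWord w _) = k
      rw [hpw (N + 1) _ le_rfl, List.take_length]
      exact hx2 N

open Classical in
/-- rank for priority `k` -/
noncomputable def dRank (c : List A → ℕ) (k : ℕ) (u : List A) : Ordinal.{0} :=
  if h : WellFounded (Desc c k) then (h.apply u).rank else 0

lemma dRank_le (c : List A → ℕ) (k : ℕ) (u : List A) (a : A) (h : k ≤ c (u ++ [a])) :
    dRank c k (u ++ [a]) ≤ dRank c k u := by
  unfold dRank
  split_ifs with hwf
  · rw [(hwf.apply (u ++ [a])).rank_eq]
    apply Ordinal.iSup_le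
    rintro ⟨z, x, hx0, rfl, hx2, hx3⟩
    rw [Order.succ_le_iff]
    have hd : Desc c k (u ++ [a] ++ x) u := by
      refine ⟨a :: x, by simp, by simp, hx2, ?_⟩
      intro y hy0 hy
      cases y with
      | nil => exact absurd rfl hy0
      | cons b y =>
        rw [List.cons_prefix_cons] at hy
        obtain ⟨rfl, hy⟩ := hy
        by_cases hy1 : y = []
        · subst hy1; exact h
        · have := hx3 y hy1 hy
          simpa using this
    exact Acc.rank_lt_of_rel (hwf.apply u) hd
  · exact le_rfl

lemma dRank_lt (c : List A → ℕ) (k : ℕ) (hwf : WellFounded (Desc c k)) (u : List A) (a : A)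
    (h : c (u ++ [a]) = k) : dRank c k (u ++ [a]) < dRank c k u := by
  unfold dRank
  rw [dif_pos hwf, dif_pos hwf]
  refine Acc.rank_lt_of_rel (hwf.apply u) ⟨[a], by simp, rfl, h, ?_⟩
  intro y hy0 hy
  cases y with
  | nil => exact absurd rfl hy0
  | cons b y =>
    rw [List.cons_prefix_cons] at hy
    obtain ⟨rfl, hy⟩ := hy
    obtain rfl : y = [] := List.prefix_nil.1 hy
    exact h.ge

/-- truncation of signatures -/
noncomputable def trunc {d : ℕ} (k : ℕ) (f : Fin d → Ordinal.{0}) : Fin d → Ordinal.{0} :=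
  fun i => if i.1 ≤ k then f i else 0

lemma trunc_le {d : ℕ} (k : ℕ) (f g : Fin d → Ordinal.{0}) (h : toLex f ≤ toLex g) :
    toLex (trunc k f) ≤ toLex (trunc k g) := by
  rcases h.eq_or_lt with h | h
  · rw [toLex_inj.1 h]
  · obtain ⟨i, h1, h2⟩ := h
    by_cases hi : i.1 ≤ k
    · apply le_of_lt
      refine ⟨i, fun j hj => ?_, ?_⟩
      · have := h1 j hj
        simp only [Pi.toLex_apply] at this ⊢
        simp only [trunc, this]
      · simp only [Pi.toLex_apply] at h2 ⊢
        simp only [trunc, if_pos hi]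
        exact h2
    · apply le_of_eq
      congr 1
      funext j
      unfold trunc
      split_ifs with hj
      · exact h1 j (by show j.1 < i.1; omega)
      · rfl

lemma positional {X : Type} [Finite X] (p : X → ℕ) (h : List A → X)
    (hp : ∀ w : ℕ → A, ParOK (fun n => p (h (prefixWord w n)))) :
    ∃ rep : X → List A, (∀ u, h (rep (h u)) = h u) ∧
      ∀ (w : ℕ → A) (x : ℕ → X), (∃ u, x 0 = h u) →
        (∀ n, x (n + 1) = h (rep (x n) ++ [w n])) → ParOK (fun n => p (x n)) := by
  obtain ⟨d, hd⟩ : ∃ d, ∀ x, p x < d := by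
    have := Fintype.ofFinite X
    exact ⟨Finset.univ.sup p + 1, fun x => Nat.lt_succ_of_le (Finset.le_sup (Finset.mem_univ x))⟩
  set c : List A → ℕ := fun u => p (h u) with hcdef
  let sig : List A → Fin d → Ordinal.{0} := fun u i => if Odd i.1 then dRank c i.1 u else 0
  have hrep : ∀ x, ∃ u, (∃ v, h v = x) → h u = x ∧ ∀ v, h v = x → toLex (sig u) ≤ toLex (sig v) := by
    intro x
    by_cases hx : ∃ v, h v = x
    · obtain ⟨u, hu, hmin⟩ := (InvImage.wf (fun u => toLex (sig u))
        (wellFounded_lt (α := Lex (Fin d → Ordinal.{0})))).has_min {u | h u = x} hx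
      exact ⟨u, fun _ => ⟨hu, fun v hv => not_lt.1 (hmin v hv)⟩⟩
    · exact ⟨[], fun h => absurd h hx⟩
  choose rep hrep using hrep
  refine ⟨rep, fun u => (hrep (h u) ⟨u, rfl⟩).1, ?_⟩
  intro w x hx0 hx k hk ⟨⟨N, hN⟩, hinf⟩
  have hreach : ∀ n, ∃ v, h v = x n := by
    intro n
    cases n with
    | zero => exact hx0.imp fun _ h => h.symm
    | succ n => exact ⟨_, (hx n).symm⟩
  have hkd : k < d := by
    obtain ⟨n, -, h1⟩ := hinf 0
    rw [← h1]; exact hd _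
  let s : ℕ → Lex (Fin d → Ordinal.{0}) := fun n => toLex (trunc k (sig (rep (x n))))
  have hle1 : ∀ n, s (n + 1) ≤ toLex (trunc k (sig (rep (x n) ++ [w n]))) := fun n =>
    trunc_le k _ _ ((hrep _ (hreach (n + 1))).2 _ (hx n).symm)
  have hpt : ∀ n, N ≤ n → trunc k (sig (rep (x n) ++ [w n])) ≤ trunc k (sig (rep (x n))) := by
    intro n hn i
    simp only [trunc, sig]
    split_ifs with h1 h2
    · apply dRank_le
      have := hN (n + 1) (by omega)
      show i.1 ≤ p (h (rep (x n) ++ [w n]))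
      rw [← hx n]
      exact h1.trans this
    · exact le_rfl
    · exact le_rfl
  have hle : ∀ n, N ≤ n → s (n + 1) ≤ s n := fun n hn =>
    (hle1 n).trans (Pi.toLex_monotone (hpt n hn))
  have hlt : ∀ n, N ≤ n → p (x (n + 1)) = k → s (n + 1) < s n := by
    intro n hn hpk
    refine (hle1 n).trans_lt (Pi.toLex_strictMono (Pi.lt_def.2 ⟨hpt n hn, ⟨k, hkd⟩, ?_⟩))
    simp only [trunc, sig, le_refl, if_true, if_pos hk]
    apply dRank_lt c k (desc_wf c hp k hk)
    show p (h (rep (x n) ++ [w n])) = k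
    rw [← hx n, hpk]
  obtain ⟨z, ⟨n0, hn0, rfl⟩, hmin⟩ := (wellFounded_lt (α := Lex (Fin d → Ordinal.{0}))).has_min
    {z | ∃ n, N ≤ n ∧ s n = z} ⟨_, N, le_rfl, rfl⟩
  obtain ⟨m, hm1, hm2⟩ := hinf (n0 + 1)
  obtain ⟨m, rfl⟩ : ∃ l, m = l + 1 := ⟨m - 1, by omega⟩
  have hanti : ∀ n, n0 ≤ n → s n ≤ s n0 := by
    intro n hn
    induction n, hn using Nat.le_induction with
    | base => exact le_rfl
    | succ n hn ih => exact (hle n (by omega)).trans ih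
  exact hmin (s (m + 1)) ⟨m + 1, by omega, rfl⟩
    ((hlt m (by omega) hm2).trans_le (hanti m (by omega)))

/-- the record along a history -/
def histRec {V : Type} (h : List A → V) (u : List A) (v w : V) : Prop :=
  ∀ k, k ≤ u.length → h (u.take k) = w → ∃ j, k ≤ j ∧ j ≤ u.length ∧ h (u.take j) = v

/-- strategy enriched with records -/
def histLar {V : Type} (h : List A → V) (u : List A) : LSt V :=
  (h u, histRec h u, {v | histRec h u.dropLast v (h u)})

lemma histLar_step {V : Type} (h : List A → V) (u : List A) (a : A) :
    LarStep (histLar h u) (histLar h (u ++ [a])) := by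
  constructor
  · intro v w
    show histRec h (u ++ [a]) v w ↔ (v = h (u ++ [a]) ∨ (w ≠ h (u ++ [a]) ∧ histRec h u v w))
    have ht : ∀ k, k ≤ u.length → (u ++ [a]).take k = u.take k := fun k hk =>
      List.take_append_of_le_length hk
    have hl : (u ++ [a]).length = u.length + 1 := by simp
    have hf : (u ++ [a]).take (u.length + 1) = u ++ [a] := by rw [← hl, List.take_length]
    constructor
    · intro hr
      by_cases hv : v = h (u ++ [a])
      · exact Or.inl hv
      · refine Or.inr ⟨?_, ?_⟩
        · rintro rfl
          obtain ⟨j, h1, h2, h3⟩ := hr (u.length + 1) (by omega) (by rw [hf])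
          obtain rfl : j = u.length + 1 := by omega
          rw [hf] at h3
          exact hv h3.symm
        · intro k hk hw
          obtain ⟨j, h1, h2, h3⟩ := hr k (by omega) (by rw [ht k hk, hw])
          have hj : j ≤ u.length := by
            by_contra hj
            obtain rfl : j = u.length + 1 := by omega
            rw [hf] at h3
            exact hv h3.symm
          exact ⟨j, h1, hj, by rw [← ht j hj, h3]⟩
    · rintro (rfl | ⟨h1, h2⟩) k hk hw
      · exact ⟨u.length + 1, by omega, by omega, by rw [hf]⟩
      · have hk' : k ≤ u.length := by
          by_contra hk'
          obtain rfl : k = u.length + 1 := by omega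
          rw [hf] at hw
          exact h1 hw.symm
        rw [ht k hk'] at hw
        obtain ⟨j, h3, h4, h5⟩ := h2 k hk' hw
        exact ⟨j, h3, by omega, by rw [ht j h4, h5]⟩
  · show {v | histRec h (u ++ [a]).dropLast v (h (u ++ [a]))} = {v | histRec h u v (h (u ++ [a]))}
    rw [List.dropLast_concat]

lemma histLar_init {V : Type} (h : List A → V) (v w : V) :
    (histLar h []).2.1 v w ↔ ((histLar h []).1 = w → (histLar h []).1 = v) := by
  show histRec h [] v w ↔ (h [] = w → h [] = v)
  constructor
  · intro hr hw
    obtain ⟨j, -, -, h3⟩ := hr 0 le_rfl hw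
    simpa using h3
  · intro hr k hk hw
    exact ⟨k, le_rfl, hk, by simpa using hr (by simpa using hw)⟩

/-- finite memory suffices for Muller conditions -/
lemma finite_memory {V : Type} [Finite V] (W : Set V → Prop) (E : V → A → Set V) (h : List A → V)
    (hE : ∀ u a, h (u ++ [a]) ∈ E (h u) a)
    (hW : ∀ w : ℕ → A, W (InfOcc (fun n => h (prefixWord w n)))) :
    ∃ (Mem : Type) (_ : Finite Mem) (T : Transducer A V Mem), T.out T.m0 = h [] ∧
      (∀ m a, T.out (T.upd m a) ∈ E (T.out m) a) ∧
      ∀ (w : ℕ → A) (μ : ℕ → Mem), μ 0 = T.m0 → (∀ n, μ (n + 1) = T.upd (μ n) (w n)) →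
        W (InfOcc (fun n => T.out (μ n))) := by
  obtain ⟨rep, hrep, hpos⟩ := positional (larPrio W) (histLar h) (fun w => by
    rw [lar_parity W (fun n => histLar h (prefixWord w n)) (histLar_init h)]
    · exact hW w
    · intro n
      rw [prefixWord_succ]
      exact histLar_step h _ _)
  refine ⟨Set.range (histLar h), inferInstance,
    ⟨⟨histLar h [], [], rfl⟩, fun m a => ⟨histLar h (rep m.1 ++ [a]), _, rfl⟩, fun m => m.1.1⟩,
    rfl, ?_, ?_⟩
  · rintro ⟨m, u, rfl⟩ a
    have := hE (rep (histLar h u)) a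
    have e : h (rep (histLar h u)) = h u := congrArg Prod.fst (hrep u)
    rw [e] at this
    exact this
  · intro w μ h0 hμ
    have hμ' : ∀ n, (μ (n + 1)).1 = histLar h (rep (μ n).1 ++ [w n]) := fun n => by rw [hμ n]
    rw [← lar_parity W (fun n => (μ n).1)]
    · exact hpos w (fun n => (μ n).1) ⟨[], by simp [h0]⟩ hμ'
    · rw [h0]
      exact histLar_init h
    · intro n
      have := histLar_step h (rep (μ n).1) (w n)
      rw [← hμ' n] at this
      obtain ⟨u, hu⟩ := (μ n).2
      rwa [← hu, hrep u, hu] at this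

end PosPart

/-! ### Part 6: finite-state witnesses -/

section WitPart

lemma exists_ext (u : List A) (a : A) :
    ∃ w : ℕ → A, prefixWord w u.length = u ∧ prefixWord w (u.length + 1) = u ++ [a] := by
  have h : prefixWord (fun n => (u[n]?).getD a) u.length = u := by
    apply List.ext_getElem?
    intro m
    by_cases hm : m < u.length
    · simp [prefixWord, hm]
    · rw [List.getElem?_eq_none (by rw [prefixWord_length]; omega),
        List.getElem?_eq_none (by omega)]
  refine ⟨fun n => (u[n]?).getD a, h, ?_⟩
  rw [prefixWord_succ, h]
  simp

lemma strategy_step {M : Auto A Q} {acc : Set Q → Prop} {g : List A → Q}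
    (hg : IsGFGStrategy M acc g) (u : List A) (a : A) : g (u ++ [a]) ∈ M.next (g u) a := by
  obtain ⟨w, h1, h2⟩ := exists_ext u a
  have h3 := (hg w).1.2 u.length
  have h4 : w u.length = a := by
    rw [prefixWord_succ, h1] at h2
    simpa using h2
  simp only [StrategyRun, h1, h2, h4] at h3
  exact h3

lemma run_snoc (T : Transducer A Q Mem) (m : Mem) (u : List A) (a : A) :
    T.run m (u ++ [a]) = T.upd (T.run m u) a := by
  simp [Transducer.run]

lemma run_eq_seq (T : Transducer A Q Mem) (w : ℕ → A) (μ : ℕ → Mem)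
    (h : ∀ n, μ (n + 1) = T.upd (μ n) (w n)) (n : ℕ) :
    T.run (μ 0) (prefixWord w n) = μ n := by
  induction n with
  | zero => rfl
  | succ n ih => rw [prefixWord_succ, run_snoc, ih, h]

lemma wit_iff (T : Transducer A Q Mem) (M : Auto A Q) (acc : Set Q → Prop) :
    IsGFGStrategy M acc T.strategy ↔ ∀ (w : ℕ → A) (μ : ℕ → Mem), μ 0 = T.m0 →
      (∀ n, μ (n + 1) = T.upd (μ n) (w n)) →
      M.IsRun w (fun n => T.out (μ n)) ∧ (w ∈ M.Lang acc → acc (InfOcc fun n => T.out (μ n))) := by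
  constructor
  · intro h w μ h0 hs
    have : StrategyRun T.strategy w = fun n => T.out (μ n) := by
      funext n
      show T.out (T.run T.m0 (prefixWord w n)) = _
      rw [← h0, run_eq_seq T w μ hs]
    rw [← this]
    exact h w
  · intro h w
    exact h w (fun n => T.run T.m0 (prefixWord w n)) rfl
      (fun n => by rw [prefixWord_succ, run_snoc])

lemma finite_witness [Finite Q] [Nonempty A] (M : Auto A Q) (acc : Set Q → Prop)
    (hg : IsGFG M acc) :
    ∃ (Mem : Type) (_ : Finite Mem) (T : Transducer A Q Mem), IsGFGStrategy M acc T.strategy := by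
  obtain ⟨g, hg⟩ := hg
  obtain ⟨X, hX, x0, upd, F, hF⟩ := mcnaughton M acc
  have hdet : ∀ (w : ℕ → A), w ∈ M.Lang acc ↔
      F (InfOcc fun n => (prefixWord w n).foldl upd x0) := by
    intro w
    refine hF w _ rfl ?_
    intro n
    rw [prefixWord_succ, List.foldl_append]
    rfl
  obtain ⟨Mem, hMem, T, h0, hE, hW⟩ := finite_memory (V := X × Q)
    (fun I => F (Prod.fst '' I) → acc (Prod.snd '' I))
    (fun v a => {y | y.1 = upd v.1 a ∧ y.2 ∈ M.next v.2 a})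
    (fun u => (u.foldl upd x0, g u))
    (fun u a => ⟨by simp, strategy_step hg u a⟩)
    (fun w => by
      rw [image_infOcc, image_infOcc]
      intro h
      exact (hg w).2 ((hdet w).2 h))
  refine ⟨Mem, hMem, ⟨T.m0, T.upd, fun m => (T.out m).2⟩, ?_⟩
  rw [wit_iff]
  intro w μ hμ0 hμ
  have hst : ∀ n, T.out (μ (n + 1)) ∈
      {y : X × Q | y.1 = upd (T.out (μ n)).1 (w n) ∧ y.2 ∈ M.next (T.out (μ n)).2 (w n)} := by
    intro n
    have e := hμ n
    simp only at e
    rw [e]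
    exact hE (μ n) (w n)
  have hμ0' : T.out (μ 0) = (x0, g []) := by
    rw [hμ0]; exact h0
  refine ⟨⟨?_, fun n => (hst n).2⟩, ?_⟩
  · show (T.out (μ 0)).2 ∈ M.init
    rw [hμ0']
    exact (hg w).1.1
  · intro hw
    have h1 := hW w μ hμ0 hμ
    simp only [image_infOcc] at h1
    apply h1
    exact (hF w _ (by rw [hμ0']) (fun n => (hst n).1)).1 hw

end WitPart

/-! ### Part 7: tightening -/

section TightPart

lemma infOcc_shift (r : ℕ → Q) (k : ℕ) : InfOcc (fun n => r (k + n)) = InfOcc r := by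
  ext q
  constructor
  · intro h N
    obtain ⟨m, h1, h2⟩ := h N
    exact ⟨k + m, by omega, h2⟩
  · intro h N
    obtain ⟨m, h1, h2⟩ := h (k + N)
    exact ⟨m - k, by omega, by show r (k + (m - k)) = q; rw [show k + (m - k) = m by omega]; exact h2⟩

lemma restrict_reachable (T : Transducer A Q Mem) (M : Auto A Q) (acc : Set Q → Prop)
    (h : IsGFGStrategy M acc T.strategy) :
    ∃ T' : Transducer A Q {m // T.Reachable m}, IsGFGStrategy M acc T'.strategy := by
  refine ⟨⟨⟨T.m0, [], rfl⟩, fun m a => ⟨T.upd m.1 a, ?_⟩, fun m => T.out m.1⟩, ?_⟩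
  · obtain ⟨u, hu⟩ := m.2
    exact ⟨u ++ [a], by rw [run_snoc, hu]⟩
  · rw [wit_iff] at h ⊢
    intro w μ h0 hμ
    exact h w (fun n => (μ n).1) (by rw [h0]) (fun n => by rw [hμ n])

lemma good_reach (T : Transducer A Q Mem) (M : Auto A Q) (acc : Set Q → Prop)
    (h : IsGFGStrategy M acc T.strategy) (u : List A) :
    ∀ (w : ℕ → A) (μ : ℕ → Mem), μ 0 = T.run T.m0 u → (∀ n, μ (n + 1) = T.upd (μ n) (w n)) →
      w ∈ (M.withInit (T.out (μ 0))).Lang acc → acc (InfOcc fun n => T.out (μ n)) := by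
  induction u using List.reverseRecOn with
  | nil =>
    rintro w μ h0 hμ ⟨r, ⟨hr0, hr⟩, ha⟩
    have hw := (wit_iff T M acc).1 h w μ h0 hμ
    refine hw.2 ⟨r, ⟨?_, hr⟩, ha⟩
    have : r 0 = T.out (μ 0) := hr0
    rw [this]
    exact hw.1.1
  | append_singleton u a ih =>
    rintro w μ h0 hμ ⟨r, ⟨hr0, hr⟩, ha⟩
    have hr0' : r 0 = T.out (μ 0) := hr0
    rw [run_snoc] at h0
    let w' : ℕ → A := fun n => Nat.casesOn n a w
    let μ' : ℕ → Mem := fun n => Nat.casesOn n (T.run T.m0 u) μ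
    let r' : ℕ → Q := fun n => Nat.casesOn n (T.out (T.run T.m0 u)) r
    have hsh : ∀ s : ℕ → Q, (fun n => s (1 + n)) = fun n => s (n + 1) := fun s => by
      funext n; rw [Nat.add_comm]
    have h1 := ih w' μ' rfl (by
      intro n
      cases n with
      | zero => exact h0
      | succ n => exact hμ n) ⟨r', ⟨rfl, by
        intro n
        cases n with
        | zero =>
          show r 0 ∈ M.next (T.out (T.run T.m0 u)) a
          rw [hr0', h0]
          have := strategy_step h u a
          simp only [Transducer.strategy, run_snoc] at this
          exact this
        | succ n => exact hr n⟩, by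
        rw [← infOcc_shift r' 1, hsh]
        exact ha⟩
    rw [← infOcc_shift _ 1, hsh (fun n => T.out (μ' n))] at h1
    exact h1

lemma prefix_prefixWord (w : ℕ → A) (n : ℕ) (v : List A) :
    v <+: prefixWord w n ↔ ∃ t, t ≤ n ∧ v = prefixWord w t := by
  have key : ∀ t, t ≤ n → (prefixWord w n).take t = prefixWord w t := by
    intro t ht
    simp only [prefixWord]
    rw [← List.map_take, List.take_range, Nat.min_eq_left ht]
  constructor
  · intro h
    have hl := h.length_le
    rw [prefixWord_length] at hl
    exact ⟨v.length, hl, by rw [← key _ hl]; exact List.prefix_iff_eq_take.1 h⟩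
  · rintro ⟨t, ht, rfl⟩
    rw [← key t ht]
    exact List.take_prefix _ _

open Classical in
lemma replace_step [Finite Mem] (T : Transducer A Q Mem) (M : Auto A Q) (acc : Set Q → Prop)
    (h : IsGFGStrategy M acc T.strategy) (hreach : ∀ x, T.Reachable x)
    (m m' : Mem) (hne : m ≠ m') (hout : T.out m = T.out m') (hrep : T.Replaceable acc m m') :
    ∃ T' : Transducer A Q {x // x ≠ m}, IsGFGStrategy M acc T'.strategy := by
  let rd : Mem → {x // x ≠ m} := fun x => if hx : x = m then ⟨m', hne.symm⟩ else ⟨x, hx⟩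
  have rd1 : ∀ x, x ≠ m → (rd x).1 = x := fun x hx => by simp [rd, hx]
  have rd2 : (rd m).1 = m' := by simp [rd]
  have rdout : ∀ x, T.out (rd x).1 = T.out x := by
    intro x
    by_cases hx : x = m
    · rw [hx, rd2, hout]
    · rw [rd1 x hx]
  refine ⟨⟨rd T.m0, fun x a => rd (T.upd x.1 a), fun x => T.out x.1⟩, ?_⟩
  rw [wit_iff]
  intro w μ hμ0 hμ
  let ν : ℕ → Mem := fun n => (μ n).1
  have hν0 : ν 0 = (rd T.m0).1 := by simp only [ν, hμ0]
  have hν : ∀ n, ν (n + 1) = (rd (T.upd (ν n) (w n))).1 := fun n => by simp only [ν, hμ n]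
  have hstep : ∀ x a, T.out (T.upd x a) ∈ M.next (T.out x) a := by
    intro x a
    obtain ⟨u, rfl⟩ := hreach x
    have := strategy_step h u a
    simp only [Transducer.strategy, run_snoc] at this
    exact this
  refine ⟨⟨?_, ?_⟩, ?_⟩
  · show T.out (ν 0) ∈ M.init
    rw [hν0, rdout]
    exact (h w).1.1
  · intro n
    show T.out (ν (n + 1)) ∈ M.next (T.out (ν n)) (w n)
    rw [hν, rdout]
    exact hstep _ _
  intro hw
  show acc (InfOcc fun n => T.out (ν n))
  have good : ∀ (x : Mem) (w : ℕ → A) (κ : ℕ → Mem), κ 0 = x →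
      (∀ n, κ (n + 1) = T.upd (κ n) (w n)) →
      w ∈ (M.withInit (T.out x)).Lang acc → acc (InfOcc fun n => T.out (κ n)) := by
    intro x w κ h0 hκ hl
    obtain ⟨u, hu⟩ := hreach x
    refine good_reach T M acc h u w κ (by rw [h0, hu]) hκ ?_
    rw [h0]; exact hl
  have inv : ∀ n, (fun i => w (n + i)) ∈ (M.withInit (T.out (ν n))).Lang acc := by
    intro n
    induction n with
    | zero =>
      rw [hν0, rdout]
      simp only [Nat.zero_add]
      exact ⟨_, ⟨rfl, (h w).1.2⟩, (h w).2 hw⟩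
    | succ n ih =>
      rw [hν, rdout]
      let κ : ℕ → Mem := fun i => T.run (ν n) (prefixWord (fun i => w (n + i)) i)
      have hκ : ∀ i, κ (i + 1) = T.upd (κ i) (w (n + i)) := fun i => by
        simp only [κ]; rw [prefixWord_succ, run_snoc]
      have ha := good (ν n) _ κ rfl hκ ih
      refine ⟨fun i => T.out (κ (1 + i)), ⟨?_, ?_⟩, ?_⟩
      · show T.out (κ (1 + 0)) = T.out (T.upd (ν n) (w n))
        rw [show 1 + 0 = 0 + 1 by omega, hκ]
        rfl
      · intro i
        show T.out (κ (1 + (i + 1))) ∈ M.next (T.out (κ (1 + i))) (w (n + 1 + i))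
        rw [show 1 + (i + 1) = (1 + i) + 1 by omega, hκ, show n + (1 + i) = n + 1 + i by omega]
        exact hstep _ _
      · rw [infOcc_shift (fun i => T.out (κ i)) 1]
        exact ha
  let J : ℕ → Prop := fun n => T.upd (ν n) (w n) = m
  have hJ : ∀ n, J n → ν (n + 1) = m' := fun n hn => by rw [hν, show T.upd (ν n) (w n) = m from hn, rd2]
  have hnJ : ∀ n, ¬ J n → ν (n + 1) = T.upd (ν n) (w n) := fun n hn => by rw [hν, rd1 _ hn]
  by_cases hfin : ∃ K, ∀ n, K ≤ n → ¬ J n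
  · obtain ⟨K, hK⟩ := hfin
    rw [← infOcc_shift (fun n => T.out (ν n)) K]
    exact good (ν K) _ (fun n => ν (K + n)) rfl
      (fun n => hnJ (K + n) (hK _ (by omega))) (inv K)
  · push Not at hfin
    obtain ⟨N1, hN1⟩ := infOcc_late ν
    let S : Set (List A) := {u | ∃ i l, N1 ≤ i ∧ ν i = m' ∧ J (i + l) ∧ (∀ t, t < l → ¬ J (i + t)) ∧
      u = prefixWord (fun n => w (i + n)) (l + 1)}
    -- runs along segments
    have hseg : ∀ i l, ν i = m' → (∀ t, t < l → ¬ J (i + t)) → ∀ t, t ≤ l →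
        T.run m' (prefixWord (fun n => w (i + n)) t) = ν (i + t) := by
      intro i l hi hl t ht
      induction t with
      | zero => exact hi.symm
      | succ t ih =>
        rw [prefixWord_succ, run_snoc, ih (by omega)]
        exact (hnJ (i + t) (hl t (by omega))).symm
    have hend : ∀ i l, ν i = m' → (∀ t, t < l → ¬ J (i + t)) → J (i + l) →
        T.run m' (prefixWord (fun n => w (i + n)) (l + 1)) = m := by
      intro i l hi hl hj
      rw [prefixWord_succ, run_snoc, hseg i l hi hl l le_rfl]
      exact hj
    have hSsub : S ⊆ T.PathSet m' m := by
      rintro u ⟨i, l, -, hi, hj, hl, rfl⟩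
      refine ⟨?_, hend i l hi hl hj⟩
      apply List.ne_nil_of_length_pos
      rw [prefixWord_length]
      omega
    obtain ⟨j0, hj0, hJ0⟩ := hfin N1
    have hcover : ∀ n, j0 + 1 ≤ n → ∃ i l, N1 ≤ i ∧ ν i = m' ∧ J (i + l) ∧
        (∀ t, t < l → ¬ J (i + t)) ∧ i ≤ n ∧ n ≤ i + l := by
      intro n hn
      have g1 : J (Nat.findGreatest J (n - 1)) :=
        Nat.findGreatest_spec (P := J) (m := j0) (by omega) hJ0
      have g2 : j0 ≤ Nat.findGreatest J (n - 1) := Nat.le_findGreatest (by omega) hJ0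
      have g3 : Nat.findGreatest J (n - 1) ≤ n - 1 := Nat.findGreatest_le _
      have g4 : ∀ k, Nat.findGreatest J (n - 1) < k → k ≤ n - 1 → ¬ J k := fun k a b =>
        Nat.findGreatest_is_greatest a b
      set g := Nat.findGreatest J (n - 1)
      have hex : ∃ f, n ≤ f ∧ J f := hfin n
      have f1 := Nat.find_spec hex
      have f2 : ∀ k, k < Nat.find hex → ¬ (n ≤ k ∧ J k) := fun k hk => Nat.find_min hex hk
      set f := Nat.find hex
      refine ⟨g + 1, f - (g + 1), by omega, hJ g g1, ?_, ?_, by omega, by omega⟩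
      · rw [show g + 1 + (f - (g + 1)) = f by omega]; exact f1.2
      · intro t ht hJt
        by_cases hc : g + 1 + t < n
        · exact g4 (g + 1 + t) (by omega) (by omega) hJt
        · exact f2 (g + 1 + t) (by omega) ⟨by omega, hJt⟩
    have hSne : S.Nonempty := by
      obtain ⟨i, l, a, b, c, d, -, -⟩ := hcover (j0 + 1) le_rfl
      exact ⟨_, i, l, a, b, c, d, rfl⟩
    have hcomb : T.AllCombosAcc acc m' m := by
      rcases hrep with h1 | h1
      · obtain ⟨u, hu⟩ := hSne
        have := hSsub hu
        rw [h1] at this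
        exact absurd this (Set.notMem_empty u)
      · exact h1
    have hfinal := hcomb S hSne hSsub
    have heq : T.out '' (⋃ u ∈ S, T.pathStates m' u) = InfOcc fun n => T.out (ν n) := by
      rw [← image_infOcc]
      apply Set.Subset.antisymm
      · rintro q ⟨x, hx, rfl⟩
        simp only [Set.mem_iUnion] at hx
        obtain ⟨u, ⟨i, l, hi1, hi, hj, hl, rfl⟩, v, hv, rfl⟩ := hx
        obtain ⟨t, ht, rfl⟩ := (prefix_prefixWord _ _ _).1 hv
        rcases Nat.lt_or_ge l t with hlt | hle
        · obtain rfl : t = l + 1 := by omega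
          rw [hend i l hi hl hj, hout, ← hi]
          exact ⟨_, hN1 i hi1, rfl⟩
        · rw [hseg i l hi hl t hle]
          exact ⟨_, hN1 (i + t) (by omega), rfl⟩
      · rintro q ⟨x, hx, rfl⟩
        obtain ⟨n, hn, rfl⟩ := hx (j0 + 1)
        obtain ⟨i, l, a, b, c, d, e, f⟩ := hcover n hn
        refine ⟨ν n, ?_, rfl⟩
        simp only [Set.mem_iUnion]
        refine ⟨_, ⟨i, l, a, b, c, d, rfl⟩, _,
          (prefix_prefixWord _ _ _).2 ⟨n - i, by omega, rfl⟩, ?_⟩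
        rw [hseg i l b d (n - i) (by omega), show i + (n - i) = n by omega]
    unfold Transducer.accG at hfinal
    rw [heq] at hfinal
    exact hfinal

lemma card_subtype_lt [Finite Mem] (P : Mem → Prop) (m : Mem) (hm : ¬ P m) :
    Nat.card {x // P x} < Nat.card Mem :=
  Finite.card_subtype_lt hm

end TightPart

/-- Every GFG automaton has an equivalent tight GFG automaton with the
same acceptance condition, defined on a substructure. -/
theorem stmt2 {A Q : Type} [Fintype A] [Fintype Q]
    (M : Auto A Q) (acc : Set Q → Prop) (hgfg : IsGFG M acc) :
    ∃ M' : Auto A Q,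
      M'.init ⊆ M.init ∧ (∀ q a, M'.next q a ⊆ M.next q a) ∧
      IsGFG M' acc ∧ Tight M' acc ∧ M'.Lang acc = M.Lang acc := by
  rcases isEmpty_or_nonempty A with hA | hA
  · obtain ⟨g, hg⟩ := hgfg
    refine ⟨M, subset_rfl, fun _ _ => subset_rfl, ⟨g, hg⟩, ⟨Unit, inferInstance,
      ⟨(), fun _ _ => (), fun _ => g []⟩, fun w => hA.elim (w 0), fun _ a => hA.elim a,
      fun m m' hne => absurd rfl hne⟩, rfl⟩
  · classical
    have hex : ∃ n, ∃ (Mem : Type) (_ : Finite Mem) (T : Transducer A Q Mem),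
        IsGFGStrategy M acc T.strategy ∧ Nat.card Mem = n := by
      obtain ⟨Mem, hM, T, hT⟩ := finite_witness M acc hgfg
      exact ⟨_, Mem, hM, T, hT, rfl⟩
    obtain ⟨Mem, hMem, T, hT, hcard⟩ := Nat.find_spec hex
    have hmin : ∀ (P : Mem → Prop) (T' : Transducer A Q {x // P x}),
        IsGFGStrategy M acc T'.strategy → ∀ m, P m := by
      intro P T' hT' m
      by_contra hm
      have h1 := card_subtype_lt P m hm
      rw [hcard] at h1
      exact Nat.find_min hex h1 ⟨_, inferInstance, T', hT', rfl⟩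
    have hreach : ∀ x, T.Reachable x := by
      obtain ⟨T', hT'⟩ := restrict_reachable T M acc hT
      exact hmin _ T' hT'
    let M' : Auto A Q := ⟨{T.strategy []}, fun q a => {q' | T.Uses q a q'}⟩
    have hi : M'.init ⊆ M.init := by
      rintro q rfl
      exact (hT (fun _ => hA.some)).1.1
    have hn : ∀ q a, M'.next q a ⊆ M.next q a := by
      rintro q a q' ⟨u, rfl, rfl⟩
      exact strategy_step hT u a
    have hrun : ∀ w, M'.IsRun w (StrategyRun T.strategy w) := by
      intro w
      refine ⟨rfl, fun n => ⟨prefixWord w n, rfl, ?_⟩⟩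
      rw [← prefixWord_succ]
      rfl
    have hL : M'.Lang acc = M.Lang acc := by
      ext w
      constructor
      · rintro ⟨r, ⟨h1, h2⟩, h3⟩
        exact ⟨r, ⟨hi h1, fun n => hn _ _ (h2 n)⟩, h3⟩
      · intro hw
        exact ⟨_, hrun w, (hT w).2 hw⟩
    have hT' : IsGFGStrategy M' acc T.strategy := fun w =>
      ⟨hrun w, fun hw => (hT w).2 (by rw [← hL]; exact hw)⟩
    refine ⟨M', hi, hn, ⟨_, hT'⟩, ⟨Mem, Fintype.ofFinite Mem, T, hT', fun _ _ _ h => h, ?_⟩, hL⟩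
    intro m m' hne hout hrep
    obtain ⟨T2, hT2⟩ := replace_step T M acc hT hreach m m' hne hout hrep
    exact hmin _ T2 hT2 m rfl


end GFG
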